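/- Let Γ be a Coxeter graph with vertex set S and let X ⊆ S. Let β, γ ∈ Φ[Γ_X], and suppose there exist s, t ∈ S and w ∈ W[Γ] such that β = w(α_s) and γ = w(α_t). Then there exist x, y ∈ X and u ∈ W_X[Γ] such that β = u(α_x) and γ = u(α_y). -/

import Mathlib

/-- The coefficient `⟨α_s, α_t⟩` of the canonical bilinear form: `-2 cos (π / m_{s,t})` if
`m_{s,t} ≠ ∞` and `-2` if `m_{s,t} = ∞` (recall `M s t = 0` encodes `∞`). -/
noncomputable def bilinCoeff {S : Type*} (M : CoxeterMatrix S) (s t : S) : ℝ :=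
  if M s t = 0 then -2 else -2 * Real.cos (Real.pi / (M s t))

/-- The canonical symmetric bilinear form on `V = ⊕_{s ∈ S} ℝ α_s`, identified with `S → ℝ`. -/
noncomputable def canonicalForm {S : Type*} [Fintype S] (M : CoxeterMatrix S) (v w : S → ℝ) : ℝ :=
  ∑ s, ∑ t, v s * w t * bilinCoeff M s t

/-- The simple root `α_s`, as an element of `S → ℝ`. -/
noncomputable def simpleRoot {S : Type*} [DecidableEq S] (s : S) : S → ℝ :=
  Pi.single s 1

/-- The action of the generator `s` in the canonical representation:
`v ↦ v - ⟨v, α_s⟩ α_s`. -/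
noncomputable def simpleReflection {S : Type*} [Fintype S] [DecidableEq S] (M : CoxeterMatrix S)
    (s : S) : Function.End (S → ℝ) :=
  fun v => v - canonicalForm M v (simpleRoot s) • simpleRoot s

lemma bilinCoeff_comm {S : Type*} {M : CoxeterMatrix S} (s t : S) :
    bilinCoeff M s t = bilinCoeff M t s := by
  simp [bilinCoeff, M.symmetric s t]

lemma bilinCoeff_self {S : Type*} {M : CoxeterMatrix S} (s : S) : bilinCoeff M s s = 2 := by
  simp [bilinCoeff]

lemma simpleRoot_apply {S : Type*} [DecidableEq S] (s r : S) :
    simpleRoot s r = if r = s then 1 else 0 := by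
  simp [simpleRoot, Pi.single_apply]

lemma simpleRoot_nonneg {S : Type*} [DecidableEq S] (s : S) : 0 ≤ simpleRoot s := fun r => by
  rw [simpleRoot_apply]; split_ifs <;> simp

/-- The canonical bilinear form as a bundled bilinear map. -/
noncomputable def canonicalBilin {S : Type*} [Fintype S] [DecidableEq S] (M : CoxeterMatrix S) :
    LinearMap.BilinForm ℝ (S → ℝ) :=
  Matrix.toBilin' (Matrix.of (bilinCoeff M))

/-- The simple reflection as a linear endomorphism. -/
noncomputable def linearReflection {S : Type*} [Fintype S] [DecidableEq S] (M : CoxeterMatrix S)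
    (s : S) : Module.End ℝ (S → ℝ) :=
  LinearMap.id - ((canonicalBilin M).flip (simpleRoot s)).smulRight (simpleRoot s)

section CanonicalRepresentation

variable {S : Type*} [Fintype S] [DecidableEq S] {M : CoxeterMatrix S}

lemma canonicalBilin_apply (v w : S → ℝ) : canonicalBilin M v w = canonicalForm M v w := by
  simp only [canonicalBilin, Matrix.toBilin'_apply, canonicalForm, Matrix.of_apply]
  exact Finset.sum_congr rfl fun _ _ => Finset.sum_congr rfl fun _ _ => by ring

lemma linearReflection_apply (s : S) (v : S → ℝ) :
    linearReflection M s v = v - canonicalBilin M v (simpleRoot s) • simpleRoot s := by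
  simp [linearReflection]

lemma canonicalBilin_simpleRoot (s t : S) :
    canonicalBilin M (simpleRoot s) (simpleRoot t) = bilinCoeff M s t := by
  simp [canonicalBilin, simpleRoot, Matrix.toBilin'_single]

lemma canonicalBilin_comm (v w : S → ℝ) : canonicalBilin M v w = canonicalBilin M w v := by
  simp only [canonicalBilin, Matrix.toBilin'_apply, Matrix.of_apply]
  rw [Finset.sum_comm]
  exact Finset.sum_congr rfl fun i _ => Finset.sum_congr rfl fun j _ => by
    rw [bilinCoeff_comm]; ring

lemma canonicalBilin_linearReflection (s : S) (v w : S → ℝ) :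
    canonicalBilin M (linearReflection M s v) (linearReflection M s w) =
      canonicalBilin M v w := by
  simp only [linearReflection_apply, map_sub, map_smul, LinearMap.sub_apply, LinearMap.smul_apply,
    smul_eq_mul, canonicalBilin_simpleRoot, bilinCoeff_self, canonicalBilin_comm (simpleRoot s) w]
  ring

/-- A representation by arbitrary self-maps that sends generators to simple reflections is
linear. -/
lemma exists_linear_lift (ρ : M.Group →* Function.End (S → ℝ))
    (hρ : ∀ s : S, ρ (M.simple s) = simpleReflection M s) :
    ∃ σ : M.Group →* Module.End ℝ (S → ℝ),
      (∀ s, σ (M.simple s) = linearReflection M s) ∧ ∀ w v, ρ w v = σ w v := by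
  have hs (s : S) (v : S → ℝ) : ρ (M.simple s) v = linearReflection M s v := by
    rw [hρ, linearReflection_apply, canonicalBilin_apply]; rfl
  have key (w : M.Group) : ∃ f : Module.End ℝ (S → ℝ), ∀ v, ρ w v = f v := by
    induction w using M.toCoxeterSystem.simple_induction with
    | simple i => exact ⟨linearReflection M i, hs i⟩
    | one => exact ⟨1, fun v => by rw [map_one]; rfl⟩
    | mul w w' h h' =>
      obtain ⟨f, hf⟩ := h
      obtain ⟨g, hg⟩ := h'
      refine ⟨f * g, fun v => ?_⟩
      rw [map_mul, Module.End.mul_apply, ← hg, ← hf]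
      rfl
  choose σ hσ using key
  refine ⟨⟨⟨σ, ?_⟩, ?_⟩, ?_, hσ⟩
  · refine LinearMap.ext fun v => ?_
    rw [← hσ, map_one]; rfl
  · intro w w'
    refine LinearMap.ext fun v => ?_
    rw [Module.End.mul_apply, ← hσ, ← hσ, ← hσ, map_mul]
    rfl
  · intro s
    refine LinearMap.ext fun v => ?_
    exact (hσ _ v).symm.trans (hs s v)

variable {σ : M.Group →* Module.End ℝ (S → ℝ)}

lemma canonicalBilin_map (hσ : ∀ s, σ (M.simple s) = linearReflection M s) (w : M.Group)
    (a b : S → ℝ) : canonicalBilin M (σ w a) (σ w b) = canonicalBilin M a b := by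
  induction w using M.toCoxeterSystem.simple_induction_left with
  | one => simp
  | mul_simple_left w i h =>
    rw [M.toCoxeterSystem_simple, map_mul, hσ, Module.End.mul_apply, Module.End.mul_apply,
      canonicalBilin_linearReflection, h]

lemma map_eq_zero_of_notMem (hσ : ∀ s, σ (M.simple s) = linearReflection M s) {X : Set S}
    {u : M.Group} (hu : u ∈ Subgroup.closure (M.simple '' X)) {v : S → ℝ}
    (hv : ∀ r ∉ X, v r = 0) : ∀ r ∉ X, σ u v r = 0 := by
  have step (s : S) (hs : s ∈ X) (y : M.Group) (hy : ∀ r ∉ X, σ y v r = 0) :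
      ∀ r ∉ X, σ (M.simple s * y) v r = 0 := by
    intro r hr
    rw [map_mul, hσ, Module.End.mul_apply, linearReflection_apply, Pi.sub_apply, hy r hr,
      Pi.smul_apply, simpleRoot_apply, if_neg (ne_of_mem_of_not_mem hs hr).symm]
    simp
  induction hu using Subgroup.closure_induction_left with
  | one => simpa using hv
  | mul_left x hx y hy h =>
    obtain ⟨s, hs, rfl⟩ := hx
    exact step s hs y h
  | inv_mul_cancel x hx y hy h =>
    obtain ⟨s, hs, rfl⟩ := hx
    have : (M.simple s)⁻¹ = M.simple s := M.toCoxeterSystem.inv_simple s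
    rw [this]
    exact step s hs y h

end CanonicalRepresentation

/-- The values at `c` of the Chebyshev polynomials of the second kind, shifted by one. -/
def chebyshevSeq (c : ℝ) : ℕ → ℝ
  | 0 => 0
  | 1 => 1
  | n + 2 => 2 * c * chebyshevSeq c (n + 1) - chebyshevSeq c n

lemma chebyshevSeq_one (n : ℕ) : chebyshevSeq 1 n = n := by
  induction n using Nat.twoStepInduction with
  | zero => simp [chebyshevSeq]
  | one => simp [chebyshevSeq]
  | more n h h' => rw [chebyshevSeq, h, h']; push_cast; ring

lemma chebyshevSeq_cos_mul_sin (θ : ℝ) (n : ℕ) :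
    chebyshevSeq (Real.cos θ) n * Real.sin θ = Real.sin (n * θ) := by
  induction n using Nat.twoStepInduction with
  | zero => simp [chebyshevSeq]
  | one => simp [chebyshevSeq]
  | more n h h' =>
    rw [chebyshevSeq, sub_mul, mul_assoc, h, h']
    have h₁ : ((n + 2 : ℕ) : ℝ) * θ = ((n + 1 : ℕ) : ℝ) * θ + θ := by push_cast; ring
    have h₂ : (n : ℝ) * θ = ((n + 1 : ℕ) : ℝ) * θ - θ := by push_cast; ring
    rw [h₁, h₂, Real.sin_add, Real.sin_sub]
    ring

lemma chebyshevSeq_cos_nonneg {m n : ℕ} (hm : 2 ≤ m) (hn : n ≤ m) :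
    0 ≤ chebyshevSeq (Real.cos (Real.pi / m)) n := by
  have hm' : (2 : ℝ) ≤ m := by exact_mod_cast hm
  have hn' : (n : ℝ) ≤ m := by exact_mod_cast hn
  have hsin : 0 < Real.sin (Real.pi / m) :=
    Real.sin_pos_of_pos_of_lt_pi (by positivity) (div_lt_self Real.pi_pos (by linarith))
  refine nonneg_of_mul_nonneg_left ?_ hsin
  rw [chebyshevSeq_cos_mul_sin]
  refine Real.sin_nonneg_of_nonneg_of_le_pi (by positivity) ?_
  rw [mul_div_assoc', div_le_iff₀ (by linarith), mul_comm]
  gcongr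

section Positivity

open CoxeterSystem

variable {S : Type*} [Fintype S] [DecidableEq S] {M : CoxeterMatrix S}
  {σ : M.Group →* Module.End ℝ (S → ℝ)}

lemma map_alternatingWord_simpleRoot (hσ : ∀ s, σ (M.simple s) = linearReflection M s)
    {s t : S} {c : ℝ} (hc : bilinCoeff M s t = -2 * c) (k : ℕ) :
    σ (M.toCoxeterSystem.wordProd (alternatingWord s t k)) (simpleRoot s) =
      if Even k then
        chebyshevSeq c (k + 1) • simpleRoot s + chebyshevSeq c k • simpleRoot t
      else
        chebyshevSeq c k • simpleRoot s + chebyshevSeq c (k + 1) • simpleRoot t := by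
  have hc' : bilinCoeff M t s = -2 * c := by rw [bilinCoeff_comm, hc]
  induction k with
  | zero => simp [alternatingWord, chebyshevSeq]
  | succ k ih =>
    rw [alternatingWord_succ', wordProd_cons, map_mul, Module.End.mul_apply, ih,
      M.toCoxeterSystem_simple, hσ, linearReflection_apply]
    by_cases hk : Even k
    · simp only [hk, if_true, Nat.even_add_one, not_true, if_false, map_add, map_smul,
        LinearMap.add_apply, LinearMap.smul_apply, canonicalBilin_simpleRoot, bilinCoeff_self, hc,
        smul_eq_mul]
      rw [show chebyshevSeq c (k + 1 + 1) = 2 * c * chebyshevSeq c (k + 1) - chebyshevSeq c k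
        from rfl]
      module
    · simp only [hk, if_false, Nat.even_add_one, not_false_iff, if_true, map_add, map_smul,
        LinearMap.add_apply, LinearMap.smul_apply, canonicalBilin_simpleRoot, bilinCoeff_self, hc',
        smul_eq_mul]
      rw [show chebyshevSeq c (k + 1 + 1) = 2 * c * chebyshevSeq c (k + 1) - chebyshevSeq c k
        from rfl]
      module

/-- If `s` is not a right descent of `w`, then `w(α_s)` is a positive root. -/
theorem map_simpleRoot_nonneg (hσ : ∀ s, σ (M.simple s) = linearReflection M s) (w : M.Group)
    (s : S) (hws : ¬ M.toCoxeterSystem.IsRightDescent w s) : 0 ≤ σ w (simpleRoot s) := by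
  induction hn : M.toCoxeterSystem.length w using Nat.strong_induction_on generalizing w s with
  | _ n ih =>
  subst hn
  set cs := M.toCoxeterSystem
  by_cases hw1 : w = 1
  · subst hw1; simpa using simpleRoot_nonneg s
  obtain ⟨t, ht⟩ := cs.exists_rightDescent_of_ne_one hw1
  have hst : s ≠ t := by rintro rfl; exact hws ht
  let P : ℕ → Prop := fun k => ∃ v, w = v * cs.wordProd (alternatingWord s t k) ∧
    cs.length w = cs.length v + k
  have hP1 : P 1 := by
    refine ⟨w * cs.simple t, ?_, (cs.isRightDescent_iff.1 ht).symm⟩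
    simp [alternatingWord]
  have hbound : ∀ k, P k → k ≤ cs.length w := fun k ⟨v, _, h⟩ => by omega
  obtain ⟨k, hk1, ⟨v, hv, hl⟩, hmax⟩ :
      ∃ k, 1 ≤ k ∧ P k ∧ ¬ P (k + 1) := by
    classical
    refine ⟨Nat.findGreatest P (cs.length w), Nat.le_findGreatest (hbound 1 hP1) hP1,
      Nat.findGreatest_spec (hbound 1 hP1) hP1, fun h => ?_⟩
    have := Nat.le_findGreatest (hbound _ h) h
    omega
  have hnext : ¬ cs.IsRightDescent v (if Even k then t else s) := by
    intro h
    refine hmax ⟨v * cs.simple (if Even k then t else s), ?_, ?_⟩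
    · rw [alternatingWord_succ', wordProd_cons, mul_assoc, simple_mul_simple_cancel_left, hv]
    · have := cs.isRightDescent_iff.1 h
      omega
  have hprev : ¬ cs.IsRightDescent v (if Even k then s else t) := by
    intro h
    obtain ⟨j, rfl⟩ : ∃ j, k = j + 1 := ⟨k - 1, by omega⟩
    have hle := cs.length_mul_le (v * cs.simple (if Even (j + 1) then s else t))
      (cs.wordProd (alternatingWord s t j))
    have hw : v * cs.simple (if Even (j + 1) then s else t) *
        cs.wordProd (alternatingWord s t j) = w := by
      rw [hv, alternatingWord_succ', wordProd_cons, mul_assoc]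
      congr 3
      by_cases hj : Even j <;> simp [hj, Nat.even_add_one]
    have h1 := cs.length_wordProd_le (alternatingWord s t j)
    have h2 := cs.isRightDescent_iff.1 h
    rw [hw] at hle
    rw [length_alternatingWord] at h1
    omega
  have hvs : ¬ cs.IsRightDescent v s := by
    by_cases hk : Even k
    · simpa [hk] using hprev
    · simpa [hk] using hnext
  have hvt : ¬ cs.IsRightDescent v t := by
    by_cases hk : Even k
    · simpa [hk] using hnext
    · simpa [hk] using hprev
  have hs0 := ih _ (by omega) v s hvs rfl
  have ht0 := ih _ (by omega) v t hvt rfl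
  have hred : cs.IsReduced (alternatingWord t s (k + 1)) := by
    have hws' := cs.not_isRightDescent_iff.1 hws
    have h1 := cs.length_wordProd_le (alternatingWord t s (k + 1))
    have h2 := cs.length_mul_le v (cs.wordProd (alternatingWord t s (k + 1)))
    have h3 : v * cs.wordProd (alternatingWord t s (k + 1)) = w * cs.simple s := by
      rw [alternatingWord_succ, wordProd_concat, hv, mul_assoc]
    rw [h3] at h2
    unfold CoxeterSystem.IsReduced
    rw [length_alternatingWord] at h1 ⊢
    omega
  have hkm (h : M s t ≠ 0) : k + 1 ≤ M s t := by
    rw [M.symmetric] at h ⊢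
    by_contra hlt
    exact cs.not_isReduced_alternatingWord t s h (not_le.1 hlt) hred
  obtain ⟨c, hc, hpos⟩ : ∃ c, bilinCoeff M s t = -2 * c ∧
      ∀ j ≤ k + 1, 0 ≤ chebyshevSeq c j := by
    by_cases h : M s t = 0
    · exact ⟨1, by simp [bilinCoeff, h], fun j _ => by simp [chebyshevSeq_one]⟩
    · refine ⟨Real.cos (Real.pi / M s t), by simp [bilinCoeff, h], fun j hj =>
        chebyshevSeq_cos_nonneg ?_ (hj.trans (hkm h))⟩
      have := M.off_diagonal s t hst
      omega
  have e1 := hpos k (by omega)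
  have e2 := hpos (k + 1) le_rfl
  rw [hv, map_mul, Module.End.mul_apply, map_alternatingWord_simpleRoot hσ hc]
  split_ifs
  · rw [map_add, map_smul, map_smul]
    exact add_nonneg (smul_nonneg e2 hs0) (smul_nonneg e1 ht0)
  · rw [map_add, map_smul, map_smul]
    exact add_nonneg (smul_nonneg e1 hs0) (smul_nonneg e2 ht0)

lemma map_simpleRoot_nonneg_or_nonpos (hσ : ∀ s, σ (M.simple s) = linearReflection M s)
    (w : M.Group) (s : S) : 0 ≤ σ w (simpleRoot s) ∨ σ w (simpleRoot s) ≤ 0 := by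
  by_cases h : M.toCoxeterSystem.IsRightDescent w s
  · right
    have h' := map_simpleRoot_nonneg hσ _ s
      (M.toCoxeterSystem.isRightDescent_iff_not_isRightDescent_mul.1 h)
    rw [M.toCoxeterSystem_simple, map_mul, hσ, Module.End.mul_apply, linearReflection_apply,
      canonicalBilin_simpleRoot, bilinCoeff_self] at h'
    rw [← neg_nonneg, ← map_neg]
    convert h' using 2
    module
  · exact Or.inl (map_simpleRoot_nonneg hσ w s h)

lemma eq_simpleRoot_of_map_eq_smul (hσ : ∀ s, σ (M.simple s) = linearReflection M s)
    {w : M.Group} {s x : S} {c : ℝ} (hc : 0 ≤ c) (h : σ w (simpleRoot x) = c • simpleRoot s) :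
    σ w (simpleRoot x) = simpleRoot s := by
  have hB := canonicalBilin_map hσ w (simpleRoot x) (simpleRoot x)
  rw [h] at hB
  simp only [map_smul, LinearMap.smul_apply, canonicalBilin_simpleRoot, bilinCoeff_self,
    smul_eq_mul] at hB
  have : c = 1 := by nlinarith
  rw [h, this, one_smul]

/-- Let `w` have no left descent in `X`. If a root `w(α_s)` lies in the span of the `α_x`,
`x ∈ X`, then it is one of these simple roots. -/
lemma exists_map_simpleRoot_eq (hσ : ∀ s, σ (M.simple s) = linearReflection M s) {X : Set S}
    {w : M.Group} (hw : ∀ x ∈ X, ¬ M.toCoxeterSystem.IsLeftDescent w x) (s : S)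
    (hs : ∀ r ∉ X, σ w (simpleRoot s) r = 0) : ∃ x ∈ X, σ w (simpleRoot s) = simpleRoot x := by
  set δ := σ w (simpleRoot s) with hδ
  have hpos (x : S) (hx : x ∈ X) : 0 ≤ σ w⁻¹ (simpleRoot x) :=
    map_simpleRoot_nonneg hσ _ _
      (fun h => hw x hx (M.toCoxeterSystem.isRightDescent_inv_iff.1 h))
  have hcancel (v : S → ℝ) : σ w (σ w⁻¹ v) = v := by
    rw [← Module.End.mul_apply, ← map_mul, mul_inv_cancel, map_one, Module.End.one_apply]
  have hexp (r : S) : simpleRoot s r = ∑ x, δ x * σ w⁻¹ (simpleRoot x) r := by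
    have h1 : σ w⁻¹ δ = simpleRoot s := by
      rw [hδ, ← Module.End.mul_apply, ← map_mul, inv_mul_cancel, map_one, Module.End.one_apply]
    have h2 : δ = ∑ x, δ x • simpleRoot x := by
      ext r
      simp [simpleRoot_apply]
    rw [← h1]
    conv_lhs => rw [h2]
    simp
  have hδ0 : 0 ≤ δ := by
    rcases map_simpleRoot_nonneg_or_nonpos hσ w s with h | h
    · exact h
    · exfalso
      have h1 := hexp s
      rw [simpleRoot_apply, if_pos rfl] at h1
      have h2 : ∑ x, δ x * σ w⁻¹ (simpleRoot x) s ≤ 0 := by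
        refine Finset.sum_nonpos fun x _ => ?_
        by_cases hx : x ∈ X
        · exact mul_nonpos_of_nonpos_of_nonneg (h x) (hpos x hx s)
        · rw [hs x hx, zero_mul]
      linarith
  have hterm (r x : S) : 0 ≤ δ x * σ w⁻¹ (simpleRoot x) r := by
    by_cases hx : x ∈ X
    · exact mul_nonneg (hδ0 x) (hpos x hx r)
    · rw [hs x hx, zero_mul]
  obtain ⟨x, hx⟩ : ∃ x, δ x ≠ 0 := by
    by_contra! h
    have := hexp s
    simp [h, simpleRoot_apply] at this
  have hxX : x ∈ X := by
    by_contra h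
    exact hx (hs x h)
  refine ⟨x, hxX, ?_⟩
  have hmul : σ w⁻¹ (simpleRoot x) = (σ w⁻¹ (simpleRoot x) s) • simpleRoot s := by
    ext r
    rw [Pi.smul_apply, simpleRoot_apply]
    split_ifs with hr
    · simp [hr]
    · have h1 := hexp r
      rw [simpleRoot_apply, if_neg hr] at h1
      have h2 := (Finset.sum_eq_zero_iff_of_nonneg fun x _ => hterm r x).1 h1.symm x
        (Finset.mem_univ x)
      simpa [hx] using h2
  rw [hδ, ← eq_simpleRoot_of_map_eq_smul hσ (hpos x hxX s) hmul, hcancel]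

end Positivity

lemma exists_eq_mul_not_isLeftDescent {S : Type*} {M : CoxeterMatrix S} (X : Set S) (w : M.Group) :
    ∃ u ∈ Subgroup.closure (M.simple '' X), ∃ v, w = u * v ∧
      ∀ x ∈ X, ¬ M.toCoxeterSystem.IsLeftDescent v x := by
  induction hn : M.toCoxeterSystem.length w using Nat.strong_induction_on generalizing w with
  | _ n ih =>
  subst hn
  by_cases h : ∃ x ∈ X, M.toCoxeterSystem.IsLeftDescent w x
  · obtain ⟨x, hx, hd⟩ := h
    obtain ⟨u, hu, v, huv, hv⟩ := ih _ hd _ rfl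
    refine ⟨M.simple x * u, mul_mem (Subgroup.subset_closure ⟨x, hx, rfl⟩) hu, v, ?_, hv⟩
    rw [mul_assoc, ← huv]
    exact (M.toCoxeterSystem.simple_mul_simple_cancel_left x).symm
  · push Not at h
    exact ⟨1, one_mem _, w, (one_mul w).symm, h⟩

/-- **Lemma 3.7.** Let `β, γ ∈ Φ[Γ_X]` and suppose `β = w(α_s)`, `γ = w(α_t)` for some
`s, t ∈ S` and `w ∈ W[Γ]`. Then there exist `x, y ∈ X` and `u ∈ W_X[Γ]` with `β = u(α_x)` and
`γ = u(α_y)`. Here `ρ` is the canonical representation of `W[Γ]`. -/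
theorem coxeter_roots_pair_in_parabolic {S : Type*} [Fintype S] [DecidableEq S]
    (M : CoxeterMatrix S) (X : Set S)
    (ρ : M.Group →* Function.End (S → ℝ))
    (hρ : ∀ s : S, ρ (M.simple s) = simpleReflection M s)
    (β γ : S → ℝ)
    (hβ : ∃ u ∈ Subgroup.closure (M.simple '' X), ∃ x ∈ X, ρ u (simpleRoot x) = β)
    (hγ : ∃ u ∈ Subgroup.closure (M.simple '' X), ∃ x ∈ X, ρ u (simpleRoot x) = γ)
    (s t : S) (w : M.Group)
    (hs : ρ w (simpleRoot s) = β) (ht : ρ w (simpleRoot t) = γ) :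
    ∃ x ∈ X, ∃ y ∈ X, ∃ u ∈ Subgroup.closure (M.simple '' X),
      ρ u (simpleRoot x) = β ∧ ρ u (simpleRoot y) = γ := by
  obtain ⟨σ, hσ, hρσ⟩ := exists_linear_lift ρ hρ
  obtain ⟨u, hu, v, rfl, hv⟩ := exists_eq_mul_not_isLeftDescent X w
  simp only [hρσ] at *
  have key (r : S) (δ : S → ℝ) (hr : σ (u * v) (simpleRoot r) = δ)
      (hδ : ∃ u ∈ Subgroup.closure (M.simple '' X), ∃ x ∈ X, σ u (simpleRoot x) = δ) :
      ∃ x ∈ X, σ u (simpleRoot x) = δ := by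
    obtain ⟨u', hu', x', hx', h'⟩ := hδ
    obtain ⟨x, hx, h⟩ := exists_map_simpleRoot_eq (X := X) hσ hv r (by
      have h1 : σ v (simpleRoot r) = σ (u⁻¹ * u') (simpleRoot x') := by
        rw [map_mul, Module.End.mul_apply, h', ← hr, ← Module.End.mul_apply, ← map_mul,
          inv_mul_cancel_left]
      rw [h1]
      refine map_eq_zero_of_notMem hσ (mul_mem (inv_mem hu) hu') fun q hq => ?_
      rw [simpleRoot_apply, if_neg (ne_of_mem_of_not_mem hx' hq).symm])
    exact ⟨x, hx, by rw [← h, ← hr, map_mul, Module.End.mul_apply]⟩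
  obtain ⟨x, hx, hxβ⟩ := key s β hs hβ
  obtain ⟨y, hy, hyγ⟩ := key t γ ht hγ
  exact ⟨x, hx, y, hy, u, hu, hxβ, hyγ⟩
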